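/- arXiv:2004.08702 — 2 statements merged into one kernel-verified Lean document; each statement's English description precedes it below -/
import Mathlib

section
/- (Theorem 1, angle-based big-M within a synchronous zone.) Let G be a finite oriented graph with buses N and existing lines L⁰, where each existing line k has reactance x⁰(k) > 0 and nominal capacity F⁰(k) ≥ 0. Let θ : N → ℝ and f⁰ : L⁰ → ℝ satisfy the linearized power flow relation f⁰(k) = (θ(s(k)) − θ(t(k)))/x⁰(k) and the capacity constraint |f⁰(k)| ≤ F⁰(k) for every existing line k. Let ℓ be a candidate line connecting buses i and j that lie in the same connected component of G, with reactance x¹(ℓ) > 0, and let P be any path from i to j in G. Then for every M with M ≥ (Σ_{k ∈ P} F⁰(k)·x⁰(k)) / x¹(ℓ), the disjunctive constraints with investment variable i_ℓ = 0 and flow f¹(ℓ) = 0 are satisfied, i.e. −M ≤ f¹(ℓ) − (θ(i) − θ(j))/x¹(ℓ) ≤ M. -/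
structure OrientedGraph (N L : Type) where
  s : L → N
  t : L → N
  ne : ∀ k, s k ≠ t k

namespace OrientedGraph

variable {N L : Type}

/-- A walk from `i` to `j`, traversing edges in either direction. -/
inductive Walk (G : OrientedGraph N L) : N → N → Type
  | nil (i : N) : Walk G i i
  | consFwd (k : L) {j : N} (w : Walk G (G.t k) j) : Walk G (G.s k) j
  | consBwd (k : L) {j : N} (w : Walk G (G.s k) j) : Walk G (G.t k) j

/-- The list of edges traversed by a walk. -/
def Walk.edges {G : OrientedGraph N L} : ∀ {i j : N}, G.Walk i j → List L
  | _, _, .nil _ => []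
  | _, _, .consFwd k w => k :: w.edges
  | _, _, .consBwd k w => k :: w.edges

/-- Signed sum of `g` along a walk: `+g k` for forward traversals, `-g k` backward. -/
def Walk.signedSum {G : OrientedGraph N L} : ∀ {i j : N}, G.Walk i j → (L → ℝ) → ℝ
  | _, _, .nil _, _ => 0
  | _, _, .consFwd k w, g => g k + w.signedSum g
  | _, _, .consBwd k w, g => -g k + w.signedSum g

/-- Signed incidence vector of a walk: each forward traversal of an edge counts `+1`,
each backward traversal counts `-1`. -/
def Walk.signedCount {G : OrientedGraph N L} [DecidableEq L] :
    ∀ {i j : N}, G.Walk i j → L → ℝ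
  | _, _, .nil _, _ => 0
  | _, _, .consFwd k w, e => (if e = k then 1 else 0) + w.signedCount e
  | _, _, .consBwd k w, e => (if e = k then -1 else 0) + w.signedCount e

/-- The oriented incidence matrix of the graph. -/
def inc (G : OrientedGraph N L) [DecidableEq N] : Matrix N L ℝ :=
  Matrix.of fun i ℓ => if G.s ℓ = i then 1 else if G.t ℓ = i then -1 else 0

end OrientedGraph

open OrientedGraph

/-- Theorem 1: big-M for angle-based KVL within a synchronous zone.
If `M ≥ (Σ_{k ∈ P} F⁰(k)·x⁰(k)) / x¹(ℓ)` for a path `P` from `i` to `j` in the existing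
network, then with `i_ℓ = 0` and `f¹(ℓ) = 0` the disjunctive constraints hold. -/
theorem angle_based_bigM_intra {N L : Type} [Fintype N] [Fintype L]
    (G : OrientedGraph N L) (x0 F0 : L → ℝ)
    (hx0 : ∀ k, 0 < x0 k) (hF0 : ∀ k, 0 ≤ F0 k)
    (θ : N → ℝ) (f0 : L → ℝ)
    (hkvl : ∀ k, f0 k = (θ (G.s k) - θ (G.t k)) / x0 k)
    (hcap : ∀ k, |f0 k| ≤ F0 k)
    (i j : N) (x1 : ℝ) (hx1 : 0 < x1)
    (P : G.Walk i j) (M : ℝ)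
    (hM : (P.edges.map (fun k => F0 k * x0 k)).sum / x1 ≤ M)
    (f1 : ℝ) (hf1 : f1 = 0) :
    -M ≤ f1 - (θ i - θ j) / x1 ∧ f1 - (θ i - θ j) / x1 ≤ M := by
  have hk : ∀ k, |θ (G.s k) - θ (G.t k)| ≤ F0 k * x0 k := by
    intro k
    have h := hcap k
    rw [hkvl k, abs_div, abs_of_pos (hx0 k), div_le_iff₀ (hx0 k)] at h
    exact h
  have key : |θ i - θ j| ≤ (P.edges.map (fun k => F0 k * x0 k)).sum := by
    clear hM
    induction P with
    | nil i => simp [Walk.edges]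
    | consFwd k w ih =>
      simp only [Walk.edges, List.map_cons, List.sum_cons]
      have h := abs_le.mp (hk k)
      have h2 := abs_le.mp ih
      exact abs_le.mpr ⟨by linarith [h.1, h2.1], by linarith [h.2, h2.2]⟩
    | consBwd k w ih =>
      simp only [Walk.edges, List.map_cons, List.sum_cons]
      have h := abs_le.mp (hk k)
      have h2 := abs_le.mp ih
      exact abs_le.mpr ⟨by linarith [h.2, h2.1], by linarith [h.1, h2.2]⟩
  have h3 : |(θ i - θ j) / x1| ≤ M := by
    rw [abs_div, abs_of_pos hx1]
    exact le_trans (div_le_div_of_nonneg_right key hx1.le) hM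
  have h4 := abs_le.mp h3
  subst hf1
  exact ⟨by linarith [h4.2], by linarith [h4.1]⟩
end

section
/- (Big-M for slack constraints.) Let G be a finite oriented graph with buses N and lines L, where each line k has reactance x(k) > 0 and capacity F(k) ≥ 0. Let v₁, w₁ ∈ N be two buses lying in the same connected component of G, and suppose θ : N → ℝ satisfies θ(w₁) = 0 and |θ(s(k)) − θ(t(k))| ≤ F(k)·x(k) for every line k. Then for every path P from v₁ to w₁ in G, |θ(v₁)| ≤ Σ_{k ∈ P} F(k)·x(k); hence any slack big-M constant M^slack with M^slack ≥ Σ_{k ∈ P_min} F(k)·x(k), where P_min is a shortest path from v₁ to w₁ with edge weights F·x, guarantees that the relaxed slack constraint |θ(v₁)| ≤ M^slack is never binding. -/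
open OrientedGraph

theorem walk_angle_bound {N L : Type} (G : OrientedGraph N L) (c : L → ℝ) (θ : N → ℝ)
    (hbound : ∀ k, |θ (G.s k) - θ (G.t k)| ≤ c k) {i j : N} (P : G.Walk i j) :
    |θ i - θ j| ≤ (P.edges.map c).sum := by
  induction P with
  | nil i => simp [Walk.edges]
  | consFwd k w ih =>
    simp only [Walk.edges, List.map_cons, List.sum_cons]
    exact (abs_sub_le _ (θ (G.t k)) _).trans (add_le_add (hbound k) ih)
  | consBwd k w ih =>
    simp only [Walk.edges, List.map_cons, List.sum_cons]
    exact (abs_sub_le _ (θ (G.s k)) _).trans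
      (add_le_add ((abs_sub_comm _ _).trans_le (hbound k)) ih)

/-- big-M for slack constraints.  With `θ(w₁) = 0` and angle differences
bounded by `F·x` on every line, along any path `P` from `v₁` to `w₁` we get
`|θ(v₁)| ≤ Σ_{k ∈ P} F(k)·x(k)`; hence any `M^slack` at least the weight of a shortest
path makes the relaxed slack constraint `|θ(v₁)| ≤ M^slack` never binding. -/
theorem slack_bigM_bound {N L : Type} [Fintype N] [Fintype L]
    (G : OrientedGraph N L)
    (x F : L → ℝ) (hx : ∀ k, 0 < x k) (hF : ∀ k, 0 ≤ F k)
    (v₁ w₁ : N) (θ : N → ℝ) (hslack : θ w₁ = 0)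
    (hbound : ∀ k, |θ (G.s k) - θ (G.t k)| ≤ F k * x k) :
    (∀ P : G.Walk v₁ w₁, |θ v₁| ≤ (P.edges.map (fun k => F k * x k)).sum) ∧
    (∀ M : ℝ, (∃ P : G.Walk v₁ w₁, (P.edges.map (fun k => F k * x k)).sum ≤ M) →
      |θ v₁| ≤ M) := by
  have key : ∀ P : G.Walk v₁ w₁, |θ v₁| ≤ (P.edges.map (fun k => F k * x k)).sum := by
    intro P
    have h := walk_angle_bound G (fun k => F k * x k) θ hbound P
    rwa [hslack, sub_zero] at h
  exact ⟨key, fun M ⟨P, hP⟩ => (key P).trans hP⟩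
end
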